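/- There is no (u, v, w) ∈ ℚ³ with (u,v,w) ≠ (0,0,0) satisfying 5u⁶ − 50u⁵v + 206u⁴v² − 408u³v³ + 321u²v⁴ + 10uv⁵ − 100v⁶ + 9u⁴w² − 60u³vw² + 80u²v²w² + 48uv³w² + 15v⁴w² + 3u²w⁴ − 10uvw⁴ + 6v²w⁴ − w⁶ = 0. (Equivalently, the plane sextic model D of the modular curve X(b5,ns7) has no rational points.) -/

import Mathlib

/-- The sextic form defining the model `D` of `X(b5,ns7)`, over any commutative ring. -/
def sexticForm {R : Type*} [CommRing R] (u v w : R) : R :=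
  5 * u ^ 6 - 50 * u ^ 5 * v + 206 * u ^ 4 * v ^ 2 - 408 * u ^ 3 * v ^ 3
        + 321 * u ^ 2 * v ^ 4 + 10 * u * v ^ 5 - 100 * v ^ 6
        + 9 * u ^ 4 * w ^ 2 - 60 * u ^ 3 * v * w ^ 2 + 80 * u ^ 2 * v ^ 2 * w ^ 2
        + 48 * u * v ^ 3 * w ^ 2 + 15 * v ^ 4 * w ^ 2
        + 3 * u ^ 2 * w ^ 4 - 10 * u * v * w ^ 4 + 6 * v ^ 2 * w ^ 4 - w ^ 6

/-- Modulo `7` the sextic has the single projective point `(1 : 2 : 0)`. -/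
theorem eq_of_sexticForm_eq_zero_zmod_seven :
    ∀ u v w : ZMod 7, sexticForm u v w = 0 → v = 2 * u ∧ w = 0 := by
  unfold sexticForm
  decide +kernel

theorem sexticForm_mul {R : Type*} [CommRing R] (t u v w : R) :
    sexticForm (t * u) (t * v) (t * w) = t ^ 6 * sexticForm u v w := by
  unfold sexticForm
  ring

/-- An integral zero of the sextic form has all coordinates divisible by `7`: the form takes
the value `-71 * 49 * u ^ 6` modulo `343` at points reducing to `(1 : 2 : 0)`. -/
theorem seven_dvd_of_sexticForm_eq_zero {u v w : ℤ} (h : sexticForm u v w = 0) :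
    7 ∣ u ∧ 7 ∣ v ∧ 7 ∣ w := by
  have hmod : sexticForm (u : ZMod 7) (v : ZMod 7) (w : ZMod 7) = 0 := by
    have := congrArg (Int.cast : ℤ → ZMod 7) h
    simpa [sexticForm] using this
  obtain ⟨hv, hw⟩ := eq_of_sexticForm_eq_zero_zmod_seven _ _ _ hmod
  obtain ⟨a, ha⟩ : (7 : ℤ) ∣ v - 2 * u := by
    refine (ZMod.intCast_zmod_eq_zero_iff_dvd _ 7).mp ?_
    push_cast
    rw [hv, sub_self]
  obtain ⟨b, rfl⟩ : (7 : ℤ) ∣ w := (ZMod.intCast_zmod_eq_zero_iff_dvd _ 7).mp hw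
  obtain rfl : v = 2 * u + 7 * a := by linarith
  have hu : (7 : ℤ) ∣ u := by
    refine Int.Prime.dvd_pow' (n := u) (k := 6) (p := 7) (by norm_num) ?_
    refine ⟨-10 * u ^ 6 - 250 * u ^ 5 * a - 2534 * u ^ 4 * a ^ 2 - 13440 * u ^ 3 * a ^ 3
      - 39053 * u ^ 2 * a ^ 4 - 58310 * u * a ^ 5 - 34300 * a ^ 6
      + 119 * u ^ 4 * b ^ 2 + 1316 * u ^ 3 * a * b ^ 2
      + 5096 * u ^ 2 * a ^ 2 * b ^ 2 + 8232 * u * a ^ 3 * b ^ 2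
      + 5145 * a ^ 4 * b ^ 2 + 49 * u ^ 2 * b ^ 4 + 686 * u * a * b ^ 4
      + 2058 * a ^ 2 * b ^ 4 - 343 * b ^ 6, ?_⟩
    unfold sexticForm at h
    push_cast
    linarith
  exact ⟨hu, dvd_add (hu.mul_left 2) (dvd_mul_right 7 a), dvd_mul_right 7 b⟩

theorem seven_pow_dvd_of_sexticForm_eq_zero (n : ℕ) {u v w : ℤ} (h : sexticForm u v w = 0) :
    7 ^ n ∣ u ∧ 7 ^ n ∣ v ∧ 7 ^ n ∣ w := by
  induction n generalizing u v w with
  | zero => simp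
  | succ n ih =>
    obtain ⟨⟨u, rfl⟩, ⟨v, rfl⟩, ⟨w, rfl⟩⟩ := seven_dvd_of_sexticForm_eq_zero h
    rw [sexticForm_mul] at h
    obtain ⟨hu, hv, hw⟩ := ih ((mul_eq_zero.mp h).resolve_left (by norm_num))
    rw [pow_succ']
    exact ⟨mul_dvd_mul_left 7 hu, mul_dvd_mul_left 7 hv, mul_dvd_mul_left 7 hw⟩

theorem Int.eq_zero_of_forall_seven_pow_dvd {z : ℤ} (h : ∀ n : ℕ, 7 ^ n ∣ z) : z = 0 := by
  refine Int.eq_zero_of_abs_lt_dvd (h z.natAbs) ?_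
  rw [Int.abs_eq_natAbs]
  exact_mod_cast Nat.lt_pow_self (n := z.natAbs) (a := 7) (by norm_num)

theorem eq_zero_of_sexticForm_eq_zero_int {u v w : ℤ} (h : sexticForm u v w = 0) :
    u = 0 ∧ v = 0 ∧ w = 0 :=
  ⟨Int.eq_zero_of_forall_seven_pow_dvd fun n => (seven_pow_dvd_of_sexticForm_eq_zero n h).1,
    Int.eq_zero_of_forall_seven_pow_dvd fun n => (seven_pow_dvd_of_sexticForm_eq_zero n h).2.1,
    Int.eq_zero_of_forall_seven_pow_dvd fun n => (seven_pow_dvd_of_sexticForm_eq_zero n h).2.2⟩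

theorem eq_zero_of_sexticForm_eq_zero_rat {u v w : ℚ} (h : sexticForm u v w = 0) :
    u = 0 ∧ v = 0 ∧ w = 0 := by
  obtain ⟨d, hd⟩ := IsLocalization.exist_integer_multiples (nonZeroDivisors ℤ)
    Finset.univ ![u, v, w]
  obtain ⟨a, ha⟩ := hd 0 (Finset.mem_univ _)
  obtain ⟨b, hb⟩ := hd 1 (Finset.mem_univ _)
  obtain ⟨c, hc⟩ := hd 2 (Finset.mem_univ _)
  have hd0 : ((d : ℤ) : ℚ) ≠ 0 := Int.cast_ne_zero.mpr (nonZeroDivisors.coe_ne_zero d)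
  simp only [Matrix.cons_val, zsmul_eq_mul, eq_intCast] at ha hb hc
  have habc : sexticForm a b c = 0 := by
    have hq : sexticForm (a : ℚ) b c = 0 := by rw [ha, hb, hc, sexticForm_mul, h, mul_zero]
    unfold sexticForm at hq ⊢
    exact_mod_cast hq
  obtain ⟨rfl, rfl, rfl⟩ := eq_zero_of_sexticForm_eq_zero_int habc
  simp_all


/-- The plane sextic model `D` of the modular curve `X(b5,ns7)` has no rational
points. -/
theorem sextic_model_no_rational_points :
    ¬ ∃ u v w : ℚ, ¬(u = 0 ∧ v = 0 ∧ w = 0) ∧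
      5 * u ^ 6 - 50 * u ^ 5 * v + 206 * u ^ 4 * v ^ 2 - 408 * u ^ 3 * v ^ 3
        + 321 * u ^ 2 * v ^ 4 + 10 * u * v ^ 5 - 100 * v ^ 6
        + 9 * u ^ 4 * w ^ 2 - 60 * u ^ 3 * v * w ^ 2 + 80 * u ^ 2 * v ^ 2 * w ^ 2
        + 48 * u * v ^ 3 * w ^ 2 + 15 * v ^ 4 * w ^ 2
        + 3 * u ^ 2 * w ^ 4 - 10 * u * v * w ^ 4 + 6 * v ^ 2 * w ^ 4 - w ^ 6 = 0 := by
  rintro ⟨u, v, w, hne, h⟩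
  exact hne (eq_zero_of_sexticForm_eq_zero_rat h)
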